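/- arXiv:1203.3961 — 10 statements merged into one kernel-verified Lean document; each statement's English description precedes it below -/
import Mathlib

section
/- Let M be an m×n matrix with entries in {0,1}. Then the minimum of psdrk(T) over all nonnegative real m×n matrices T whose support equals M is equal to the minimum of rank(T) over all real m×n matrices T whose support equals M. -/
open Matrix

/-- The positive semidefinite rank of a real `m × n` matrix `S`: the smallest `q`
such that there are real positive semidefinite `q × q` matrices `A k`, `B ℓ` with
`S k ℓ = tr((A k)ᵀ * B ℓ)` for all `k, ℓ`. -/
noncomputable def psdRank {m n : ℕ} (S : Matrix (Fin m) (Fin n) ℝ) : ℕ :=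
  sInf {q : ℕ | ∃ (A : Fin m → Matrix (Fin q) (Fin q) ℝ)
      (B : Fin n → Matrix (Fin q) (Fin q) ℝ),
    (∀ k, (A k).PosSemidef) ∧ (∀ ℓ, (B ℓ).PosSemidef) ∧
    ∀ k ℓ, S k ℓ = ((A k)ᵀ * B ℓ).trace}

/-- A rank factorization: a matrix over a field factors through its rank. -/
theorem Matrix.exists_eq_mul_of_rank {m n K : Type*} [Fintype m] [Fintype n] [Field K]
    (T : Matrix m n K) :
    ∃ (U : Matrix m (Fin T.rank) K) (V : Matrix (Fin T.rank) n K), T = U * V := by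
  classical
  let b : Module.Basis (Fin T.rank) K (LinearMap.range T.mulVecLin) :=
    Module.finBasisOfFinrankEq K _ rfl
  have hcol (l : n) : T.col l ∈ LinearMap.range T.mulVecLin :=
    ⟨Pi.single l 1, by simp⟩
  refine ⟨.of fun i j ↦ (b j : m → K) i, .of fun j l ↦ b.repr ⟨T.col l, hcol l⟩ j, ?_⟩
  ext i l
  have h := congrArg (fun v : LinearMap.range T.mulVecLin ↦ (v : m → K) i)
    (b.sum_repr ⟨T.col l, hcol l⟩)
  simpa [-Module.Basis.sum_repr, Matrix.mul_apply, mul_comm] using h.symm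

open scoped MatrixOrder Matrix.Norms.L2Operator in
/-- A positive semidefinite matrix has the form `Cᴴ * C`. -/
theorem Matrix.PosSemidef.exists_eq_conjTranspose_mul_self {n : Type*} [Fintype n]
    {A : Matrix n n ℝ} (hA : A.PosSemidef) : ∃ C : Matrix n n ℝ, A = Cᴴ * C := by
  classical
  exact CStarAlgebra.nonneg_iff_eq_star_mul_self.mp hA.nonneg

/-- Two positive semidefinite matrices with zero trace inner product have zero product. -/
theorem Matrix.PosSemidef.mul_eq_zero_of_trace_mul_eq_zero {n : Type*} [Fintype n]
    {A B : Matrix n n ℝ} (hA : A.PosSemidef) (hB : B.PosSemidef) (h : (A * B).trace = 0) :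
    A * B = 0 := by
  obtain ⟨C, rfl⟩ := hA.exists_eq_conjTranspose_mul_self
  obtain ⟨D, rfl⟩ := hB.exists_eq_conjTranspose_mul_self
  have hCD : C * Dᴴ = 0 := by
    rw [← trace_mul_conjTranspose_self_eq_zero_iff, ← h, conjTranspose_mul,
      conjTranspose_conjTranspose, Matrix.mul_assoc Cᴴ, trace_mul_comm Cᴴ]
    simp only [Matrix.mul_assoc]
  rw [Matrix.mul_assoc, ← Matrix.mul_assoc C, hCD, Matrix.zero_mul, Matrix.mul_zero]

theorem Matrix.PosSemidef.transpose_eq_self {n : Type*} {A : Matrix n n ℝ}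
    (hA : A.PosSemidef) : Aᵀ = A := by
  simpa using hA.isHermitian.eq

/-- For finitely many nonzero matrices there is a bilinear evaluation not vanishing on any. -/
theorem Matrix.exists_forall_dotProduct_mulVec_ne_zero {ι m n K : Type*} [Finite ι]
    [Fintype m] [Fintype n] [Field K] [Infinite K] (P : ι → Matrix m n K)
    (hP : ∀ i, P i ≠ 0) : ∃ (x : m → K) (y : n → K), ∀ i, x ⬝ᵥ (P i *ᵥ y) ≠ 0 := by
  classical
  obtain ⟨y, hy⟩ := Submodule.exists_forall_notMem_of_forall_ne_top
    (fun i ↦ LinearMap.ker (P i).mulVecLin) fun i h ↦ hP i <| by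
      rw [LinearMap.ker_eq_top] at h
      exact Matrix.ext_of_mulVec_single fun j ↦
        (LinearMap.congr_fun h (Pi.single j 1)).trans (zero_mulVec _).symm
  obtain ⟨f, hf⟩ := Module.exists_dual_forall_apply_ne_zero (K := K) (fun i ↦ P i *ᵥ y)
    fun i h ↦ hy i (by simpa using h)
  refine ⟨fun j ↦ f (Pi.single j 1), y, fun i ↦ ?_⟩
  convert hf i using 1
  conv_rhs => rw [pi_eq_sum_univ' (P i *ᵥ y)]
  simp [dotProduct, mul_comm]

/-- The entrywise square of a product through `Fin r` has psd rank at most `r`. -/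
theorem psdRank_sq_mul_le {m n r : ℕ} (U : Matrix (Fin m) (Fin r) ℝ)
    (V : Matrix (Fin r) (Fin n) ℝ) : psdRank ((U * V).map (· ^ 2)) ≤ r := by
  refine Nat.sInf_le ⟨fun k ↦ vecMulVec (U k) (U k), fun l ↦ vecMulVec (V.col l) (V.col l),
    fun k ↦ by simpa using posSemidef_vecMulVec_self_star (U k),
    fun l ↦ by simpa using posSemidef_vecMulVec_self_star (V.col l), fun k l ↦ ?_⟩
  rw [transpose_vecMulVec, vecMulVec_mul_vecMulVec, trace_vecMulVec, dotProduct_smul, smul_eq_mul, ← sq]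
  rfl

/-- A nonnegative matrix has a psd factorization of size `psdRank`. -/
theorem exists_psd_factorization {m n : ℕ} (S : Matrix (Fin m) (Fin n) ℝ)
    (hS : ∀ k l, 0 ≤ S k l) :
    ∃ (A : Fin m → Matrix (Fin (psdRank S)) (Fin (psdRank S)) ℝ)
      (B : Fin n → Matrix (Fin (psdRank S)) (Fin (psdRank S)) ℝ),
      (∀ k, (A k).PosSemidef) ∧ (∀ l, (B l).PosSemidef) ∧
      ∀ k l, S k l = ((A k)ᵀ * B l).trace := by
  refine Nat.sInf_mem (s := {q : ℕ | ∃ (A : Fin m → Matrix (Fin q) (Fin q) ℝ)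
      (B : Fin n → Matrix (Fin q) (Fin q) ℝ), (∀ k, (A k).PosSemidef) ∧
      (∀ l, (B l).PosSemidef) ∧ ∀ k l, S k l = ((A k)ᵀ * B l).trace})
    ⟨n, fun k ↦ diagonal (S k), fun l ↦ diagonal (Pi.single l 1),
      fun k ↦ PosSemidef.diagonal (hS k), fun l ↦ PosSemidef.diagonal ?_, fun k l ↦ ?_⟩
  · exact Pi.single_nonneg.mpr zero_le_one
  · simp [diagonal_transpose, trace_diagonal, Pi.single_apply]

/-- A nonnegative matrix `S` shares its support with a real matrix of rank at most `psdRank S`. -/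
theorem exists_rank_le_psdRank {m n : ℕ} (S : Matrix (Fin m) (Fin n) ℝ)
    (hS : ∀ k l, 0 ≤ S k l) :
    ∃ T : Matrix (Fin m) (Fin n) ℝ, (∀ k l, T k l ≠ 0 ↔ S k l ≠ 0) ∧ T.rank ≤ psdRank S := by
  obtain ⟨A, B, hA, hB, hAB⟩ := exists_psd_factorization S hS
  have hprod (k l) (h : S k l ≠ 0) : A k * B l ≠ 0 := fun h0 ↦ h <| by
    rw [hAB, (hA k).transpose_eq_self, h0, trace_zero]
  obtain ⟨x, y, hxy⟩ := Matrix.exists_forall_dotProduct_mulVec_ne_zero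
    (fun p : {p : Fin m × Fin n // S p.1 p.2 ≠ 0} ↦ A p.1.1 * B p.1.2)
    fun p ↦ hprod _ _ p.2
  have hT (k l) : ((of fun k ↦ x ᵥ* A k) * (of fun l ↦ B l *ᵥ y)ᵀ : Matrix _ _ ℝ) k l =
      x ⬝ᵥ ((A k * B l) *ᵥ y) := by
    rw [← mulVec_mulVec, dotProduct_mulVec]
    rfl
  refine ⟨(of fun k ↦ x ᵥ* A k) * (of fun l ↦ B l *ᵥ y)ᵀ, fun k l ↦ ⟨?_, fun h ↦ ?_⟩,
    (rank_mul_le_left _ _).trans (rank_le_width _)⟩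
  · contrapose!
    intro h
    rw [hAB, (hA k).transpose_eq_self] at h
    rw [hT, (hA k).mul_eq_zero_of_trace_mul_eq_zero (hB l) h, zero_mulVec, dotProduct_zero]
  · rw [hT]
    exact hxy ⟨(k, l), h⟩

theorem min_psdRank_eq_min_rank {m n : ℕ} (M : Matrix (Fin m) (Fin n) ℝ)
    (hM : ∀ k ℓ, M k ℓ = 0 ∨ M k ℓ = 1) :
    sInf {q : ℕ | ∃ T : Matrix (Fin m) (Fin n) ℝ,
        (∀ k ℓ, 0 ≤ T k ℓ) ∧ (∀ k ℓ, T k ℓ ≠ 0 ↔ M k ℓ = 1) ∧ psdRank T = q} =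
    sInf {q : ℕ | ∃ T : Matrix (Fin m) (Fin n) ℝ,
        (∀ k ℓ, T k ℓ ≠ 0 ↔ M k ℓ = 1) ∧ T.rank = q} := by
  have hsupp (k l) : M k l ≠ 0 ↔ M k l = 1 := by
    rcases hM k l with h | h <;> simp [h]
  have hnonneg (k l) : 0 ≤ M k l := by
    rcases hM k l with h | h <;> simp [h]
  apply le_antisymm
  · refine le_csInf ⟨_, M, hsupp, rfl⟩ ?_
    rintro _ ⟨T, hT, rfl⟩
    obtain ⟨U, V, hUV⟩ := T.exists_eq_mul_of_rank
    have hle := psdRank_sq_mul_le U V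
    rw [← hUV] at hle
    exact le_trans (Nat.sInf_le ⟨_, fun k l ↦ sq_nonneg (T k l), fun k l ↦ by simp [← hT], rfl⟩) hle
  · refine le_csInf ⟨_, M, hnonneg, hsupp, rfl⟩ ?_
    rintro _ ⟨S, hS, hSM, rfl⟩
    obtain ⟨T, hT, hle⟩ := exists_rank_le_psdRank S hS
    exact le_trans (Nat.sInf_le ⟨T, fun k l ↦ (hT k l).trans (hSM k l), rfl⟩) hle
end

section
/- Let S be a real m×n matrix of rank q. Then there exist linear subspaces U_1,…,U_m and V_1,…,V_n of ℝ^q such that for all k,ℓ: U_k ⊆ V_ℓ if and only if S(k,ℓ) = 0. -/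
open Matrix

theorem exists_subspace_lattice_embedding_of_rank {m n q : ℕ}
    (S : Matrix (Fin m) (Fin n) ℝ) (hq : S.rank = q) :
    ∃ (U : Fin m → Submodule ℝ (Fin q → ℝ)) (V : Fin n → Submodule ℝ (Fin q → ℝ)),
      ∀ k ℓ, U k ≤ V ℓ ↔ S k ℓ = 0 := by
  let W : Submodule ℝ (Fin n → ℝ) := Submodule.span ℝ (Set.range S.row)
  have hW : Module.finrank ℝ W = Module.finrank ℝ (Fin q → ℝ) := by
    rw [Module.finrank_fin_fun, ← hq, rank_eq_finrank_span_row]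
  let e : W ≃ₗ[ℝ] (Fin q → ℝ) := LinearEquiv.ofFinrankEq _ _ hW
  let r : Fin m → W := fun k => ⟨S.row k, Submodule.subset_span ⟨k, rfl⟩⟩
  refine ⟨fun k => Submodule.span ℝ {e (r k)},
    fun ℓ => LinearMap.ker (LinearMap.proj ℓ ∘ₗ W.subtype ∘ₗ e.symm.toLinearMap), fun k ℓ => ?_⟩
  simp [Submodule.span_singleton_le_iff_mem, r, Matrix.row]
end

section
/- Let S be a real m×n matrix of rank q. Then there exist linear subspaces U_1,…,U_m and V_1,…,V_n of ℝ^q with dim U_k ≤ 1 for every k, such that for all k,ℓ: U_k ⊆ V_ℓ if and only if S(k,ℓ) = 0. Concretely, one may take U_k to be the span of the k-th row of S (inside the row space of S) and V_ℓ to be the span of those rows s_k of S with S(k,ℓ) = 0. -/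
open Matrix

theorem exists_subspace_lattice_embedding_dim_le_one {m n q : ℕ}
    (S : Matrix (Fin m) (Fin n) ℝ) (hq : S.rank = q) :
    ∃ (U : Fin m → Submodule ℝ (Fin q → ℝ)) (V : Fin n → Submodule ℝ (Fin q → ℝ)),
      (∀ k, Module.finrank ℝ (U k) ≤ 1) ∧
      (∀ ℓ, V ℓ = ⨆ k ∈ {k : Fin m | S k ℓ = 0}, U k) ∧
      (∀ k ℓ, U k ≤ V ℓ ↔ S k ℓ = 0) := by
  let R : Submodule ℝ (Fin n → ℝ) := Submodule.span ℝ (Set.range S.row)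
  have hR : Module.finrank ℝ R = Module.finrank ℝ (Fin q → ℝ) := by
    rw [Module.finrank_fin_fun, ← hq, S.rank_eq_finrank_span_row]
  let e : R ≃ₗ[ℝ] (Fin q → ℝ) := LinearEquiv.ofFinrankEq _ _ hR
  let r : Fin m → R := fun k ↦ ⟨S.row k, Submodule.subset_span ⟨k, rfl⟩⟩
  let U : Fin m → Submodule ℝ (Fin q → ℝ) := fun k ↦ Submodule.span ℝ {e (r k)}
  refine ⟨U, fun ℓ ↦ ⨆ k ∈ {k : Fin m | S k ℓ = 0}, U k, fun k ↦ ?_, fun _ ↦ rfl,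
    fun k ℓ ↦ ⟨fun h ↦ ?_, fun h ↦ le_biSup U h⟩⟩
  · simpa using finrank_span_le_card (R := ℝ) ({e (r k)} : Set (Fin q → ℝ))
  · let f : (Fin q → ℝ) →ₗ[ℝ] ℝ := LinearMap.proj ℓ ∘ₗ R.subtype ∘ₗ e.symm.toLinearMap
    have hf (j : Fin m) : f (e (r j)) = S j ℓ := by simp [f, r]
    have hV : ⨆ j ∈ {j : Fin m | S j ℓ = 0}, U j ≤ LinearMap.ker f := by
      refine iSup₂_le fun j hj ↦ ?_
      rw [Submodule.span_singleton_le_iff_mem, LinearMap.mem_ker, hf]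
      exact hj
    rw [← hf]
    exact hV (h (Submodule.mem_span_singleton_self _))
end

section
/- Let S be a nonnegative real m×n matrix and let A_1,…,A_m, B_1,…,B_n be real positive semidefinite q×q matrices with S(k,ℓ) = tr(A_kᵀ B_ℓ) for all k,ℓ. Then setting U_k := range(A_k) and V_ℓ := kernel(B_ℓ), one has for all k,ℓ: U_k ⊆ V_ℓ if and only if S(k,ℓ) = 0. In particular, every positive semidefinite factorization of S of size q gives rise to a subspace-lattice embedding of S into ℝ^q. -/
open Matrix

/-- The trace of the product of two positive semidefinite real matrices vanishes exactly when
their product does. -/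
theorem Matrix.PosSemidef.trace_mul_eq_zero_iff_mul_eq_zero {ι : Type*} [Fintype ι]
    [DecidableEq ι] {A B : Matrix ι ι ℝ} (hA : A.PosSemidef) (hB : B.PosSemidef) :
    (A * B).trace = 0 ↔ B * A = 0 := by
  refine ⟨fun h ↦ ?_, fun h ↦ by rw [trace_mul_comm, h, trace_zero]⟩
  obtain ⟨C, rfl⟩ : ∃ C : Matrix ι ι ℝ, A = Cᴴ * C := by
    open scoped MatrixOrder in
    exact CStarAlgebra.nonneg_iff_eq_star_mul_self.mp hA.nonneg
  obtain ⟨D, rfl⟩ : ∃ D : Matrix ι ι ℝ, B = Dᴴ * D := by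
    open scoped MatrixOrder in
    exact CStarAlgebra.nonneg_iff_eq_star_mul_self.mp hB.nonneg
  have hDC : D * Cᴴ = 0 := by
    rw [← trace_mul_conjTranspose_self_eq_zero_iff, conjTranspose_mul,
      conjTranspose_conjTranspose, ← h, ← Matrix.mul_assoc (Cᴴ * C), trace_mul_comm _ D]
    simp only [Matrix.mul_assoc]
  rw [Matrix.mul_assoc, ← Matrix.mul_assoc D, hDC, Matrix.zero_mul, Matrix.mul_zero]

theorem psd_factorization_gives_subspace_lattice_embedding {m n q : ℕ}
    (S : Matrix (Fin m) (Fin n) ℝ) (hS : ∀ k ℓ, 0 ≤ S k ℓ)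
    (A : Fin m → Matrix (Fin q) (Fin q) ℝ) (B : Fin n → Matrix (Fin q) (Fin q) ℝ)
    (hA : ∀ k, (A k).PosSemidef) (hB : ∀ ℓ, (B ℓ).PosSemidef)
    (hfac : ∀ k ℓ, S k ℓ = ((A k)ᵀ * B ℓ).trace) :
    ∀ k ℓ, LinearMap.range (A k).mulVecLin ≤ LinearMap.ker (B ℓ).mulVecLin
      ↔ S k ℓ = 0 := by
  intro k ℓ
  have hAT : (A k)ᵀ = A k := by simpa using (hA k).isHermitian.eq
  rw [hfac, hAT, (hA k).trace_mul_eq_zero_iff_mul_eq_zero (hB ℓ), LinearMap.range_le_ker_iff,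
    ← mulVecLin_mul, ← toLin'_apply', LinearEquiv.map_eq_zero_iff]
end

section
/- For every nonnegative real m×n matrix S, the subspace-lattice embedding rank of S equals min{ psdrk(T) : T a nonnegative real m×n matrix with supp(T) = supp(S) }. -/
open Matrix

/-- The subspace-lattice embedding rank of a real `m × n` matrix `S`: the smallest `q`
such that there exist subspaces `U k`, `V ℓ` of `ℝ^q` with `U k ⊆ V ℓ ↔ S k ℓ = 0`. -/
noncomputable def sleRank {m n : ℕ} (S : Matrix (Fin m) (Fin n) ℝ) : ℕ :=
  sInf {q : ℕ | ∃ (U : Fin m → Submodule ℝ (Fin q → ℝ))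
      (V : Fin n → Submodule ℝ (Fin q → ℝ)),
    ∀ k ℓ, U k ≤ V ℓ ↔ S k ℓ = 0}

/-- The trace inner product of the Gram matrices `M * Mᵀ` and `Nᵀ * N` as a squared norm. -/
theorem trace_transpose_gram_mul_gram {q : ℕ} (M N : Matrix (Fin q) (Fin q) ℝ) :
    ((M * Mᴴ)ᵀ * (Nᴴ * N)).trace = ((N * M)ᴴ * (N * M)).trace := by
  have h : (M * Mᴴ)ᵀ = M * Mᴴ := by
    simp [conjTranspose_eq_transpose_of_trivial]
  rw [h, conjTranspose_mul, Matrix.mul_assoc, trace_mul_comm]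
  simp only [Matrix.mul_assoc]

theorem trace_transpose_gram_mul_gram_nonneg {q : ℕ} (M N : Matrix (Fin q) (Fin q) ℝ) :
    0 ≤ ((M * Mᴴ)ᵀ * (Nᴴ * N)).trace := by
  rw [trace_transpose_gram_mul_gram]
  exact (posSemidef_conjTranspose_mul_self _).trace_nonneg

theorem range_le_ker_iff_trace_gram_eq_zero {q : ℕ} (M N : Matrix (Fin q) (Fin q) ℝ) :
    LinearMap.range M.mulVecLin ≤ LinearMap.ker N.mulVecLin ↔
      ((M * Mᴴ)ᵀ * (Nᴴ * N)).trace = 0 := by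
  rw [trace_transpose_gram_mul_gram, trace_conjTranspose_mul_self_eq_zero_iff,
    LinearMap.range_le_ker_iff, ← mulVecLin_mul]
  exact map_eq_zero_iff (toLin' (R := ℝ)) (LinearEquiv.injective _)

/-- Every nonnegative matrix has a positive semidefinite factorization of size `psdRank`. -/
theorem psdRank_spec {m n : ℕ} {S : Matrix (Fin m) (Fin n) ℝ} (hS : ∀ k ℓ, 0 ≤ S k ℓ) :
    ∃ (A : Fin m → Matrix (Fin (psdRank S)) (Fin (psdRank S)) ℝ)
      (B : Fin n → Matrix (Fin (psdRank S)) (Fin (psdRank S)) ℝ),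
    (∀ k, (A k).PosSemidef) ∧ (∀ ℓ, (B ℓ).PosSemidef) ∧
    ∀ k ℓ, S k ℓ = ((A k)ᵀ * B ℓ).trace := by
  refine Nat.sInf_mem (s := {q : ℕ | ∃ (A : Fin m → Matrix (Fin q) (Fin q) ℝ)
      (B : Fin n → Matrix (Fin q) (Fin q) ℝ),
    (∀ k, (A k).PosSemidef) ∧ (∀ ℓ, (B ℓ).PosSemidef) ∧
    ∀ k ℓ, S k ℓ = ((A k)ᵀ * B ℓ).trace})
    ⟨n, fun k => diagonal (S k), fun ℓ => diagonal (Pi.single ℓ 1), fun k => ?_, fun ℓ => ?_,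
      fun k ℓ => ?_⟩
  · exact PosSemidef.diagonal (hS k)
  · exact PosSemidef.diagonal (Pi.single_nonneg.2 zero_le_one)
  · simp [trace_diagonal, Pi.single_apply]

theorem exists_submodules_of_psdFactorization {m n q : ℕ} {S : Matrix (Fin m) (Fin n) ℝ}
    (h : ∃ (A : Fin m → Matrix (Fin q) (Fin q) ℝ) (B : Fin n → Matrix (Fin q) (Fin q) ℝ),
      (∀ k, (A k).PosSemidef) ∧ (∀ ℓ, (B ℓ).PosSemidef) ∧
      ∀ k ℓ, S k ℓ = ((A k)ᵀ * B ℓ).trace) :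
    ∃ (U : Fin m → Submodule ℝ (Fin q → ℝ)) (V : Fin n → Submodule ℝ (Fin q → ℝ)),
      ∀ k ℓ, U k ≤ V ℓ ↔ S k ℓ = 0 := by
  obtain ⟨A, B, hA, hB, hS⟩ := h
  open scoped MatrixOrder in
  choose M hM using fun k => CStarAlgebra.nonneg_iff_eq_mul_star_self.1 (hA k).nonneg
  open scoped MatrixOrder in
  choose N hN using fun ℓ => CStarAlgebra.nonneg_iff_eq_star_mul_self.1 (hB ℓ).nonneg
  refine ⟨fun k => LinearMap.range (M k).mulVecLin, fun ℓ => LinearMap.ker (N ℓ).mulVecLin,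
    fun k ℓ => ?_⟩
  rw [range_le_ker_iff_trace_gram_eq_zero, hS, hM, hN, star_eq_conjTranspose,
    star_eq_conjTranspose]

theorem exists_matrix_range_eq {q : ℕ} (U : Submodule ℝ (Fin q → ℝ)) :
    ∃ M : Matrix (Fin q) (Fin q) ℝ, LinearMap.range M.mulVecLin = U := by
  obtain ⟨W, hW⟩ := U.exists_isCompl
  refine ⟨LinearMap.toMatrix' (U.projection W hW), ?_⟩
  rw [← Matrix.toLin'_apply', toLin'_toMatrix', Submodule.range_projection]

theorem exists_matrix_ker_eq {q : ℕ} (V : Submodule ℝ (Fin q → ℝ)) :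
    ∃ N : Matrix (Fin q) (Fin q) ℝ, LinearMap.ker N.mulVecLin = V := by
  obtain ⟨W, hW⟩ := V.exists_isCompl
  refine ⟨LinearMap.toMatrix' (W.projection V hW.symm), ?_⟩
  rw [← Matrix.toLin'_apply', toLin'_toMatrix', Submodule.ker_projection]

theorem exists_psdRank_le_of_submodules {m n q : ℕ} (U : Fin m → Submodule ℝ (Fin q → ℝ))
    (V : Fin n → Submodule ℝ (Fin q → ℝ)) :
    ∃ T : Matrix (Fin m) (Fin n) ℝ, (∀ k ℓ, 0 ≤ T k ℓ) ∧
      (∀ k ℓ, T k ℓ = 0 ↔ U k ≤ V ℓ) ∧ psdRank T ≤ q := by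
  choose M hM using fun k => exists_matrix_range_eq (U k)
  choose N hN using fun ℓ => exists_matrix_ker_eq (V ℓ)
  refine ⟨of fun k ℓ => ((M k * (M k)ᴴ)ᵀ * ((N ℓ)ᴴ * N ℓ)).trace,
    fun k ℓ => trace_transpose_gram_mul_gram_nonneg _ _, fun k ℓ => ?_, ?_⟩
  · rw [← hM, ← hN, range_le_ker_iff_trace_gram_eq_zero, of_apply]
  · exact Nat.sInf_le ⟨fun k => M k * (M k)ᴴ, fun ℓ => (N ℓ)ᴴ * N ℓ,
      fun k => posSemidef_self_mul_conjTranspose _,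
      fun ℓ => posSemidef_conjTranspose_mul_self _, fun _ _ => rfl⟩

theorem sleRank_eq_min_psdRank {m n : ℕ} (S : Matrix (Fin m) (Fin n) ℝ)
    (hS : ∀ k ℓ, 0 ≤ S k ℓ) :
    sleRank S = sInf {q : ℕ | ∃ T : Matrix (Fin m) (Fin n) ℝ,
      (∀ k ℓ, 0 ≤ T k ℓ) ∧ (∀ k ℓ, T k ℓ = 0 ↔ S k ℓ = 0) ∧ psdRank T = q} := by
  apply le_antisymm
  · refine le_csInf ⟨_, S, hS, fun _ _ => Iff.rfl, rfl⟩ ?_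
    rintro _ ⟨T, hT, hTS, rfl⟩
    obtain ⟨U, V, hUV⟩ := exists_submodules_of_psdFactorization (psdRank_spec hT)
    exact Nat.sInf_le ⟨U, V, fun k ℓ => (hUV k ℓ).trans (hTS k ℓ)⟩
  · obtain ⟨U, V, hUV⟩ := Nat.sInf_mem
      (s := {q : ℕ | ∃ (U : Fin m → Submodule ℝ (Fin q → ℝ))
        (V : Fin n → Submodule ℝ (Fin q → ℝ)), ∀ k ℓ, U k ≤ V ℓ ↔ S k ℓ = 0})
      ⟨_, exists_submodules_of_psdFactorization (psdRank_spec hS)⟩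
    obtain ⟨T, hT, hTUV, hle⟩ := exists_psdRank_le_of_submodules U V
    refine le_trans (Nat.sInf_le ?_) hle
    exact ⟨T, hT, fun k ℓ => (hTUV k ℓ).trans (hUV k ℓ), rfl⟩
end

section
/- Let A_1,…,A_m be real q×q matrices and α_1,…,α_m real numbers. If there exists a real positive semidefinite q×q matrix X such that tr(A_jᵀ X) = α_j for j = 1,…,m, then there exists such a positive semidefinite matrix X (satisfying the same m trace equations) with rank(X) ≤ (√(8m) + 1)/2. -/
open Matrix

/-- For symmetric nonzero `M` and a suitable `t`, the matrix `B * (1 + t • M) * Bᵀ` is the Gram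
matrix of a matrix with one column fewer than `B`. -/
lemma exists_gram_one_column_fewer {q s : ℕ} (B : Matrix (Fin q) (Fin (s + 1)) ℝ)
    {M : Matrix (Fin (s + 1)) (Fin (s + 1)) ℝ} (hM : M.IsHermitian) (hM0 : M ≠ 0) :
    ∃ (t : ℝ) (C : Matrix (Fin q) (Fin s) ℝ), C * Cᵀ = B * Bᵀ + t • (B * M * Bᵀ) := by
  set d := hM.eigenvalues
  obtain ⟨i, -, hi⟩ := Finset.exists_max_image Finset.univ (fun k => |d k|) Finset.univ_nonempty
  have hdi : d i ≠ 0 := by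
    intro h0
    apply hM0
    rw [← hM.eigenvalues_eq_zero_iff]
    ext k
    have := hi k (Finset.mem_univ k)
    rw [h0, abs_zero] at this
    exact abs_nonpos_iff.mp this
  set w : Fin (s + 1) → ℝ := fun k => 1 - d k / d i with hw
  have hw0 : ∀ k, 0 ≤ w k := by
    intro k
    have h1 : d k / d i ≤ 1 := by
      refine (le_abs_self _).trans ?_
      rw [abs_div]
      exact div_le_one_of_le₀ (hi k (Finset.mem_univ k)) (abs_nonneg _)
    simpa [hw] using h1
  have hwi : w i = 0 := by simp [hw, hdi]
  set U : Matrix (Fin (s + 1)) (Fin (s + 1)) ℝ := hM.eigenvectorUnitary.1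
  have hUU : U * Uᵀ = 1 := by
    have := Unitary.coe_mul_star_self hM.eigenvectorUnitary
    rwa [Unitary.coe_star, star_eq_conjTranspose, conjTranspose_eq_transpose_of_trivial] at this
  have hspec : M = U * diagonal d * Uᵀ := by
    have := hM.spectral_theorem
    rw [Unitary.conjStarAlgAut_apply, star_eq_conjTranspose,
      conjTranspose_eq_transpose_of_trivial] at this
    exact this
  set C : Matrix (Fin q) (Fin (s + 1)) ℝ := B * U * diagonal (fun k => √(w k)) with hC
  have hCC : C * Cᵀ = B * Bᵀ + (-(d i)⁻¹) • (B * M * Bᵀ) := by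
    have hdiag : diagonal (fun k => √(w k)) * diagonal (fun k => √(w k)) =
        1 + (-(d i)⁻¹) • diagonal d := by
      rw [diagonal_mul_diagonal, ← diagonal_one, ← diagonal_smul, diagonal_add]
      congr 1
      ext k
      rw [Real.mul_self_sqrt (hw0 k)]
      simp [hw]
      ring
    calc C * Cᵀ = B * U * (diagonal (fun k => √(w k)) * diagonal (fun k => √(w k))) * Uᵀ * Bᵀ := by
          simp only [hC, transpose_mul, diagonal_transpose, Matrix.mul_assoc]
      _ = B * (U * Uᵀ) * Bᵀ + (-(d i)⁻¹) • (B * (U * diagonal d * Uᵀ) * Bᵀ) := by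
          rw [hdiag]
          simp only [Matrix.mul_add, Matrix.add_mul, Matrix.mul_smul, Matrix.smul_mul,
            Matrix.mul_one, Matrix.mul_assoc]
      _ = _ := by rw [hUU, ← hspec, Matrix.mul_one]
  refine ⟨-(d i)⁻¹, C.submatrix id i.succAbove, ?_⟩
  rw [← hCC]
  ext a b
  simp [Matrix.mul_apply, Fin.sum_univ_succAbove _ i, hC, hwi]

/-- A linear map from symmetric matrices of size `r` to a space of dimension less than
`(r + 1).choose 2` has a nonzero element in its kernel. -/
lemma exists_isHermitian_ne_zero_map_eq_zero {r m : ℕ}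
    (f : Matrix (Fin r) (Fin r) ℝ →ₗ[ℝ] (Fin m → ℝ)) (h : m < (r + 1).choose 2) :
    ∃ M : Matrix (Fin r) (Fin r) ℝ, M.IsHermitian ∧ M ≠ 0 ∧ f M = 0 := by
  let g : (Sym2 (Fin r) → ℝ) →ₗ[ℝ] Matrix (Fin r) (Fin r) ℝ :=
    { toFun := fun v => Matrix.of fun i j => v s(i, j)
      map_add' := fun _ _ => rfl
      map_smul' := fun _ _ => rfl }
  have hker : (f ∘ₗ g).ker ≠ ⊥ := by
    apply LinearMap.ker_ne_bot_of_finrank_lt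
    simpa [Sym2.card] using h
  obtain ⟨v, hv, hv0⟩ := Submodule.exists_mem_ne_zero_of_ne_bot hker
  refine ⟨g v, ?_, ?_, hv⟩
  · ext i j
    exact congrArg v Sym2.eq_swap
  · intro h0
    apply hv0
    ext z
    induction z with
    | _ i j => exact congrFun (congrFun h0 i) j

/-- Feasible Gram matrices can be taken with at most `r` columns, where
`(r + 1).choose 2 ≤ m`. -/
lemma exists_gram_choose_le {q m : ℕ} (A : Fin m → Matrix (Fin q) (Fin q) ℝ) (α : Fin m → ℝ)
    (r : ℕ) (B : Matrix (Fin q) (Fin r) ℝ) (hB : ∀ j, ((A j)ᵀ * (B * Bᵀ)).trace = α j) :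
    ∃ (s : ℕ) (C : Matrix (Fin q) (Fin s) ℝ),
      (∀ j, ((A j)ᵀ * (C * Cᵀ)).trace = α j) ∧ (s + 1).choose 2 ≤ m := by
  induction r with
  | zero => exact ⟨0, B, hB, by simp⟩
  | succ s ih =>
    by_cases hm : (s + 1 + 1).choose 2 ≤ m
    · exact ⟨s + 1, B, hB, hm⟩
    let f : Matrix (Fin (s + 1)) (Fin (s + 1)) ℝ →ₗ[ℝ] (Fin m → ℝ) :=
      { toFun := fun M j => ((A j)ᵀ * (B * M * Bᵀ)).trace
        map_add' := fun M N => by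
          ext j
          simp [Matrix.mul_add, Matrix.add_mul]
        map_smul' := fun c M => by
          ext j
          simp }
    obtain ⟨M, hM, hM0, hfM⟩ := exists_isHermitian_ne_zero_map_eq_zero f (not_le.mp hm)
    obtain ⟨t, C, hC⟩ := exists_gram_one_column_fewer B hM hM0
    refine ih C fun j => ?_
    have hj : ((A j)ᵀ * (B * M * Bᵀ)).trace = 0 := congrFun hfM j
    rw [hC, Matrix.mul_add, trace_add, hB, Matrix.mul_smul, trace_smul, hj, smul_zero, add_zero]

theorem exists_low_rank_psd_solution {q m : ℕ}
    (A : Fin m → Matrix (Fin q) (Fin q) ℝ) (α : Fin m → ℝ)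
    (h : ∃ X : Matrix (Fin q) (Fin q) ℝ, X.PosSemidef ∧
      ∀ j, ((A j)ᵀ * X).trace = α j) :
    ∃ X : Matrix (Fin q) (Fin q) ℝ, X.PosSemidef ∧
      (∀ j, ((A j)ᵀ * X).trace = α j) ∧
      (X.rank : ℝ) ≤ (Real.sqrt (8 * m) + 1) / 2 := by
  obtain ⟨X, hX, hXA⟩ := h
  obtain ⟨B, rfl⟩ : ∃ B : Matrix (Fin q) (Fin q) ℝ, X = B * Bᵀ := by
    open scoped MatrixOrder in
    obtain ⟨B, hB⟩ := CStarAlgebra.nonneg_iff_eq_mul_star_self.mp hX.nonneg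
    exact ⟨B, by rw [hB, star_eq_conjTranspose, conjTranspose_eq_transpose_of_trivial]⟩
  obtain ⟨s, C, hC, hs⟩ := exists_gram_choose_le A α q B hXA
  refine ⟨C * Cᵀ, ?_, hC, ?_⟩
  · simpa using posSemidef_self_mul_conjTranspose C
  have hrank : (C * Cᵀ).rank ≤ s := (rank_mul_le_left _ _).trans (rank_le_width C)
  have hrank' : ((C * Cᵀ).rank : ℝ) ≤ s := by exact_mod_cast hrank
  have hs' : ((s : ℝ) + 1) * s / 2 ≤ m := by
    have : (((s + 1).choose 2 : ℕ) : ℝ) ≤ m := by exact_mod_cast hs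
    rw [Nat.cast_choose_two] at this
    simpa using this
  rcases Nat.eq_zero_or_pos s with rfl | hpos
  · have := Real.sqrt_nonneg (8 * (m : ℝ))
    push_cast at hrank'
    linarith
  · have h1 : (1 : ℝ) ≤ s := by exact_mod_cast hpos
    have : 2 * (s : ℝ) - 1 ≤ √(8 * m) := Real.le_sqrt_of_sq_le (by nlinarith)
    linarith
end

section
/- Let S be a nonnegative real m×n matrix. If a positive semidefinite factorization of S of size q exists, then there exists a positive semidefinite factorization S(k,ℓ) = tr(A_kᵀ B_ℓ) of size q with rank(A_k) ≤ √(8n+1)/2 for all k and rank(B_ℓ) ≤ √(8m+1)/2 for all ℓ. -/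
open Matrix

/-- A Hermitian matrix `D ≠ 0` can be rescaled so that `1 - t • D` is a Gram matrix with one column
fewer. -/
theorem Matrix.IsHermitian.exists_one_sub_smul_eq_mul_transpose {r : ℕ}
    {D : Matrix (Fin (r + 1)) (Fin (r + 1)) ℝ} (hD : D.IsHermitian) (hne : D ≠ 0) :
    ∃ (t : ℝ) (W : Matrix (Fin (r + 1)) (Fin r) ℝ), 1 - t • D = W * Wᵀ := by
  obtain ⟨i₀, hi₀⟩ := Finite.exists_max fun i ↦ |hD.eigenvalues i|
  have h0 : hD.eigenvalues i₀ ≠ 0 := by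
    intro h
    refine hne (hD.eigenvalues_eq_zero_iff.1 (funext fun i ↦ ?_))
    simpa [h] using hi₀ i
  set t := (hD.eigenvalues i₀)⁻¹ with ht
  have hnonneg (i) : 0 ≤ 1 - t * hD.eigenvalues i := by
    have : |t * hD.eigenvalues i| ≤ 1 := by
      rw [abs_mul, ht, abs_inv, inv_mul_le_one₀ (abs_pos.2 h0)]
      exact hi₀ i
    linarith [le_abs_self (t * hD.eigenvalues i)]
  set U : Matrix (Fin (r + 1)) (Fin (r + 1)) ℝ := ↑hD.eigenvectorUnitary
  have hUU : U * Uᵀ = 1 := by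
    have := Unitary.coe_mul_star_self hD.eigenvectorUnitary
    rwa [Unitary.coe_star, star_eq_conjTranspose, conjTranspose_eq_transpose_of_trivial] at this
  have hspec : D = U * diagonal hD.eigenvalues * Uᵀ := by
    have := hD.spectral_theorem
    rw [Unitary.conjStarAlgAut_apply, star_eq_conjTranspose,
      conjTranspose_eq_transpose_of_trivial] at this
    exact this
  have hsub : 1 - t • D = U * diagonal (fun i ↦ 1 - t * hD.eigenvalues i) * Uᵀ := by
    have hdiag : diagonal (fun i ↦ 1 - t * hD.eigenvalues i) =
        1 - t • diagonal hD.eigenvalues := by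
      ext i j
      by_cases hij : i = j <;> simp [hij]
    rw [hdiag, mul_sub, sub_mul, mul_one, hUU, Matrix.mul_smul, Matrix.smul_mul, ← hspec]
  refine ⟨t, Matrix.of fun i j ↦
    U i (i₀.succAbove j) * √(1 - t * hD.eigenvalues (i₀.succAbove j)), ?_⟩
  rw [hsub]
  ext i j
  rw [mul_apply, mul_apply, Fin.sum_univ_succAbove _ i₀]
  simp only [mul_diagonal, transpose_apply, of_apply]
  rw [ht, inv_mul_cancel₀ h0, sub_self, mul_zero, zero_mul, zero_add, ← ht]
  refine Finset.sum_congr rfl fun k _ ↦ ?_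
  linear_combination -(U i (i₀.succAbove k) * U j (i₀.succAbove k)) *
    Real.mul_self_sqrt (hnonneg (i₀.succAbove k))

/-- If `n` is smaller than the dimension of the space of symmetric matrices, then `n` trace
conditions admit a common nonzero symmetric solution. -/
theorem exists_isHermitian_ne_zero_trace_mul_eq_zero {n r : ℕ} (hn : n < (r + 1).choose 2)
    (C : Fin n → Matrix (Fin r) (Fin r) ℝ) :
    ∃ D : Matrix (Fin r) (Fin r) ℝ, D.IsHermitian ∧ D ≠ 0 ∧ ∀ l, (D * C l).trace = 0 := by
  let L : (Sym2 (Fin r) → ℝ) →ₗ[ℝ] Fin n → ℝ :=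
    { toFun := fun f l ↦ (Matrix.of (fun i j ↦ f s(i, j)) * C l).trace
      map_add' := fun f g ↦ by
        ext l
        simp [trace, mul_apply, add_mul, Finset.sum_add_distrib]
      map_smul' := fun c f ↦ by
        ext l
        simp [trace, mul_apply, mul_assoc, Finset.mul_sum] }
  have hker : LinearMap.ker L ≠ ⊥ := by
    apply LinearMap.ker_ne_bot_of_finrank_lt
    simpa [Sym2.card] using hn
  obtain ⟨f, hf, hf0⟩ := (Submodule.ne_bot_iff _).1 hker
  refine ⟨Matrix.of fun i j ↦ f s(i, j), ?_, ?_, fun l ↦ congrFun (LinearMap.mem_ker.1 hf) l⟩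
  · ext i j
    simp [Sym2.eq_swap]
  · intro h
    refine hf0 (funext fun z ↦ ?_)
    induction z with
    | _ i j => exact congrFun (congrFun h i) j

open scoped MatrixOrder in
/-- Barvinok–Pataki bound: a system of `n` trace conditions satisfied by a positive semidefinite
matrix is satisfied by one whose rank `r` has `r * (r + 1) / 2 ≤ n`. -/
theorem Matrix.PosSemidef.exists_choose_rank_le {n q : ℕ} {A : Matrix (Fin q) (Fin q) ℝ}
    (hA : A.PosSemidef) (B : Fin n → Matrix (Fin q) (Fin q) ℝ) :
    ∃ A' : Matrix (Fin q) (Fin q) ℝ, A'.PosSemidef ∧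
      (∀ l, (A'ᵀ * B l).trace = (Aᵀ * B l).trace) ∧ (A'.rank + 1).choose 2 ≤ n := by
  classical
  let P (r : ℕ) : Prop := ∃ V : Matrix (Fin q) (Fin r) ℝ,
    ∀ l, (V * Vᵀ * B l).trace = (Aᵀ * B l).trace
  have hP : ∃ r, P r := by
    obtain ⟨V, hV⟩ := CStarAlgebra.nonneg_iff_eq_star_mul_self.1 hA.nonneg
    refine ⟨q, Vᵀ, fun l ↦ ?_⟩
    rw [hV, star_eq_conjTranspose, conjTranspose_eq_transpose_of_trivial, transpose_mul, transpose_transpose]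
  obtain ⟨r, ⟨V, hV⟩, hmin⟩ : ∃ r, P r ∧ ∀ s < r, ¬ P s :=
    ⟨Nat.find hP, Nat.find_spec hP, fun _ ↦ Nat.find_min hP⟩
  have hr : (r + 1).choose 2 ≤ n := by
    by_contra! hlt
    obtain _ | r := r
    · simp at hlt
    obtain ⟨D, hD, hD0, htr⟩ :=
      exists_isHermitian_ne_zero_trace_mul_eq_zero hlt fun l ↦ Vᵀ * B l * V
    obtain ⟨t, W, hW⟩ := hD.exists_one_sub_smul_eq_mul_transpose hD0
    refine hmin r r.lt_succ_self ⟨V * W, fun l ↦ ?_⟩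
    have hcycle (M : Matrix (Fin (r + 1)) (Fin (r + 1)) ℝ) :
        (V * M * Vᵀ * B l).trace = (M * (Vᵀ * B l * V)).trace := by
      rw [Matrix.mul_assoc, Matrix.mul_assoc, trace_mul_comm, Matrix.mul_assoc]
    calc (V * W * (V * W)ᵀ * B l).trace = (V * (W * Wᵀ) * Vᵀ * B l).trace := by
          simp only [transpose_mul, Matrix.mul_assoc]
      _ = (V * (1 : Matrix (Fin (r + 1)) (Fin (r + 1)) ℝ) * Vᵀ * B l).trace := by
          rw [hcycle, hcycle, ← hW, sub_mul, trace_sub, smul_mul, trace_smul, htr, smul_zero,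
            sub_zero]
      _ = (Aᵀ * B l).trace := by rw [Matrix.mul_one, hV]
  refine ⟨V * Vᵀ, ?_, fun l ↦ ?_, ?_⟩
  · simpa using posSemidef_self_mul_conjTranspose V
  · rw [transpose_mul, transpose_transpose, hV]
  · have hrank : (V * Vᵀ).rank ≤ r :=
      (rank_mul_le_left V Vᵀ).trans (V.rank_le_card_width.trans_eq (Fintype.card_fin r))
    exact (Nat.choose_le_choose 2 (by lia)).trans hr

theorem Nat.cast_le_sqrt_div_two_of_choose_le {r n : ℕ} (h : (r + 1).choose 2 ≤ n) :
    (r : ℝ) ≤ Real.sqrt (8 * n + 1) / 2 := by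
  have h' : ((r : ℝ) + 1) * r / 2 ≤ n := by
    have := Nat.cast_choose_two ℝ (r + 1)
    push_cast [add_sub_cancel_right] at this
    rw [← this]
    exact_mod_cast h
  have hr : (0 : ℝ) ≤ r := r.cast_nonneg
  rw [le_div_iff₀ two_pos]
  exact Real.le_sqrt_of_sq_le (by nlinarith)

theorem exists_low_rank_psd_factorization {m n q : ℕ}
    (S : Matrix (Fin m) (Fin n) ℝ) (hS : ∀ k ℓ, 0 ≤ S k ℓ)
    (h : ∃ (A : Fin m → Matrix (Fin q) (Fin q) ℝ)
        (B : Fin n → Matrix (Fin q) (Fin q) ℝ),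
      (∀ k, (A k).PosSemidef) ∧ (∀ ℓ, (B ℓ).PosSemidef) ∧
      ∀ k ℓ, S k ℓ = ((A k)ᵀ * B ℓ).trace) :
    ∃ (A : Fin m → Matrix (Fin q) (Fin q) ℝ)
      (B : Fin n → Matrix (Fin q) (Fin q) ℝ),
      (∀ k, (A k).PosSemidef) ∧ (∀ ℓ, (B ℓ).PosSemidef) ∧
      (∀ k ℓ, S k ℓ = ((A k)ᵀ * B ℓ).trace) ∧
      (∀ k, ((A k).rank : ℝ) ≤ Real.sqrt (8 * n + 1) / 2) ∧
      (∀ ℓ, ((B ℓ).rank : ℝ) ≤ Real.sqrt (8 * m + 1) / 2) := by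
  obtain ⟨A, B, hA, hB, hAB⟩ := h
  choose A' hA' hA'B hA'r using fun k ↦ (hA k).exists_choose_rank_le B
  choose B' hB' hB'A hB'r using fun ℓ ↦ (hB ℓ).exists_choose_rank_le A'
  have hsymm (X Y : Matrix (Fin q) (Fin q) ℝ) : (Xᵀ * Y).trace = (Yᵀ * X).trace := by
    rw [← trace_transpose, transpose_mul, transpose_transpose]
  refine ⟨A', B', hA', hB', fun k ℓ ↦ ?_, fun k ↦ Nat.cast_le_sqrt_div_two_of_choose_le (hA'r k),
    fun ℓ ↦ Nat.cast_le_sqrt_div_two_of_choose_le (hB'r ℓ)⟩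
  rw [hAB, ← hA'B, hsymm, ← hB'A, hsymm]
end

section
/- Let S be a nonnegative real m×n matrix admitting a positive semidefinite factorization S(k,ℓ) = tr(A_kᵀ B_ℓ) of size q in which every A_k and every B_ℓ has rank at most 1. Then there exists a real m×n matrix Y with rank(Y) ≤ q such that Y(k,ℓ)² = S(k,ℓ) for all k,ℓ. Concretely, writing A_k = u_k u_kᵀ and B_ℓ = v_ℓ v_ℓᵀ with u_k, v_ℓ ∈ ℝ^q, the matrix Y(k,ℓ) := u_kᵀ v_ℓ works. -/
open Matrix

/-- A matrix of rank at most one over a field is an outer product. -/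
theorem Matrix.exists_eq_vecMulVec_of_rank_le_one {ι κ K : Type*} [Field K] [Finite ι]
    [Fintype κ] {M : Matrix ι κ K} (h : M.rank ≤ 1) :
    ∃ (w : ι → K) (c : κ → K), M = vecMulVec w c := by
  classical
  obtain ⟨w, hw⟩ := finrank_le_one_iff.mp h
  choose c hc using fun j => hw ⟨M.col j, Pi.single j 1, by simp⟩
  refine ⟨w, c, ?_⟩
  ext i j
  have := congrFun (congrArg Subtype.val (hc j)) i
  simpa [vecMulVec_apply, mul_comm] using this.symm

open scoped MatrixOrder in
/-- A real positive semidefinite matrix of rank at most one is the outer product of a vector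
with itself. -/
theorem Matrix.PosSemidef.exists_eq_vecMulVec_self {ι : Type*} [Fintype ι]
    {M : Matrix ι ι ℝ} (hM : M.PosSemidef) (h : M.rank ≤ 1) :
    ∃ u : ι → ℝ, M = vecMulVec u u := by
  classical
  obtain ⟨C, rfl⟩ := CStarAlgebra.nonneg_iff_eq_star_mul_self.mp hM.nonneg
  rw [star_eq_conjTranspose, rank_conjTranspose_mul_self] at h
  obtain ⟨w, c, rfl⟩ := exists_eq_vecMulVec_of_rank_le_one h
  have hw : 0 ≤ w ⬝ᵥ w := Finset.sum_nonneg fun i _ => mul_self_nonneg (w i)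
  refine ⟨√(w ⬝ᵥ w) • c, ?_⟩
  ext i j
  calc (star (vecMulVec w c) * vecMulVec w c) i j = (w ⬝ᵥ w) * (c i * c j) := by
        simp only [star_eq_conjTranspose, mul_apply, conjTranspose_apply, vecMulVec_apply, star_trivial, dotProduct,
          Finset.sum_mul]
        exact Finset.sum_congr rfl fun k _ => by ring
    _ = (√(w ⬝ᵥ w) * √(w ⬝ᵥ w)) * (c i * c j) := by rw [Real.mul_self_sqrt hw]
    _ = vecMulVec (√(w ⬝ᵥ w) • c) (√(w ⬝ᵥ w) • c) i j := by
        simp only [vecMulVec_apply, Pi.smul_apply, smul_eq_mul]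
        ring

theorem entrywise_sqrt_of_rank_one_psd_factorization {m n q : ℕ}
    (S : Matrix (Fin m) (Fin n) ℝ) (hS : ∀ k ℓ, 0 ≤ S k ℓ)
    (A : Fin m → Matrix (Fin q) (Fin q) ℝ) (B : Fin n → Matrix (Fin q) (Fin q) ℝ)
    (hA : ∀ k, (A k).PosSemidef) (hB : ∀ ℓ, (B ℓ).PosSemidef)
    (hrA : ∀ k, (A k).rank ≤ 1) (hrB : ∀ ℓ, (B ℓ).rank ≤ 1)
    (hfac : ∀ k ℓ, S k ℓ = ((A k)ᵀ * B ℓ).trace) :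
    ∃ (Y : Matrix (Fin m) (Fin n) ℝ) (u : Fin m → Fin q → ℝ) (v : Fin n → Fin q → ℝ),
      (∀ k, A k = vecMulVec (u k) (u k)) ∧
      (∀ ℓ, B ℓ = vecMulVec (v ℓ) (v ℓ)) ∧
      (∀ k ℓ, Y k ℓ = u k ⬝ᵥ v ℓ) ∧
      Y.rank ≤ q ∧
      (∀ k ℓ, (Y k ℓ) ^ 2 = S k ℓ) := by
  choose u hu using fun k => (hA k).exists_eq_vecMulVec_self (hrA k)
  choose v hv using fun ℓ => (hB ℓ).exists_eq_vecMulVec_self (hrB ℓ)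
  refine ⟨of u * (of v)ᵀ, u, v, hu, hv, fun k ℓ => rfl, ?_, fun k ℓ => ?_⟩
  · exact (rank_mul_le_left _ _).trans (rank_le_width _)
  · have hY : (of u * (of v)ᵀ) k ℓ = u k ⬝ᵥ v ℓ := rfl
    rw [hY, hfac, hu, hv, transpose_vecMulVec, vecMulVec_mul_vecMulVec, trace_vecMulVec,
      dotProduct_smul, smul_eq_mul, sq]
end

section
/- Let S be a nonnegative real m×n matrix with S = AX for a real m×d matrix A and a real d×n matrix X, both of rank d. Let Q_0 ⊆ ℝ^d be the convex cone generated by the columns of X and let Q_1 := { x ∈ ℝ^d : Ax ≥ 0 } (so Q_0 ⊆ Q_1). Then the nonnegative rank of S equals the minimum q such that there exist an s ∈ ℕ, a real q×s matrix C, and a linear map π : ℝ^s → ℝ^d with Q_0 ⊆ π({ x ∈ ℝ^s : Cx ≥ 0 }) ⊆ Q_1. -/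
open Matrix

/-- The nonnegative rank of a real `m × n` matrix `S`: the smallest `q` such that
there are vectors `ξ k, η ℓ ∈ ℝ₊^q` with `S k ℓ = ⟨ξ k, η ℓ⟩` for all `k, ℓ`. -/
noncomputable def nnegRank {m n : ℕ} (S : Matrix (Fin m) (Fin n) ℝ) : ℕ :=
  sInf {q : ℕ | ∃ (ξ : Fin m → Fin q → ℝ) (η : Fin n → Fin q → ℝ),
    (∀ k i, 0 ≤ ξ k i) ∧ (∀ ℓ i, 0 ≤ η ℓ i) ∧ ∀ k ℓ, S k ℓ = ξ k ⬝ᵥ η ℓ}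

/-- **Farkas' lemma** for finitely many linear functionals: a functional that is nonnegative
wherever all `a i` are nonnegative is a nonnegative combination of the `a i`. -/
theorem exists_nonneg_sum_smul_eq_of_forall_nonneg {𝕜 M : Type*} [Field 𝕜] [LinearOrder 𝕜]
    [IsStrictOrderedRing 𝕜] [AddCommGroup M] [Module 𝕜 M] {q : ℕ} (a : Fin q → M →ₗ[𝕜] 𝕜)
    (b : M →ₗ[𝕜] 𝕜) (h : ∀ x, (∀ i, 0 ≤ a i x) → 0 ≤ b x) :
    ∃ u : Fin q → 𝕜, (∀ i, 0 ≤ u i) ∧ b = ∑ i, u i • a i := by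
  induction q generalizing b with
  | zero =>
    refine ⟨0, fun i => i.elim0, LinearMap.ext fun x => ?_⟩
    have h₁ := h x fun i => i.elim0
    have h₂ := h (-x) fun i => i.elim0
    simp only [map_neg] at h₂
    simp only [Finset.univ_eq_empty, Finset.sum_empty, LinearMap.zero_apply]
    linarith
  | succ q ih =>
    by_cases hb : ∀ x, (∀ i : Fin q, 0 ≤ a i.succ x) → 0 ≤ b x
    · obtain ⟨u, hu, rfl⟩ := ih (fun i => a i.succ) b hb
      refine ⟨Fin.cons 0 u, fun i => ?_, ?_⟩
      · cases i using Fin.cases <;> simp [hu]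
      · simp [Fin.sum_univ_succ]
    push Not at hb
    obtain ⟨x₀, hx₀, hbx₀⟩ := hb
    have hneg : a 0 x₀ < 0 := by
      by_contra! h₀
      exact hbx₀.not_ge (h x₀ (Fin.cases h₀ hx₀))
    -- Rescale the violating point so that `a 0` takes the value `-1` there.
    obtain ⟨y, hy, hy₀, hby⟩ :
        ∃ y, (∀ i : Fin q, 0 ≤ a i.succ y) ∧ a 0 y = -1 ∧ b y < 0 := by
      have hpos : 0 < (-a 0 x₀)⁻¹ := inv_pos.2 (neg_pos.2 hneg)
      refine ⟨(-a 0 x₀)⁻¹ • x₀, fun i => ?_, ?_, ?_⟩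
      · rw [map_smul]; exact mul_nonneg hpos.le (hx₀ i)
      · rw [map_smul, smul_eq_mul]; field_simp [hneg.ne]
      · rw [map_smul]; exact mul_neg_of_pos_of_neg hpos hbx₀
    obtain ⟨u, hu, hbu⟩ := ih (fun i => a i.succ + a i.succ y • a 0) (b + b y • a 0) fun x hx => by
      have hxy := h (x + a 0 x • y) <| Fin.cases (by simp [hy₀]) fun i => by
        simpa [mul_comm] using hx i
      simpa [mul_comm] using hxy
    refine ⟨Fin.cons (∑ i, u i * a i.succ y - b y) u, fun i => ?_, LinearMap.ext fun x => ?_⟩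
    · cases i using Fin.cases with
      | zero =>
        have := Finset.sum_nonneg fun i (_ : i ∈ Finset.univ) => mul_nonneg (hu i) (hy i)
        simp only [Fin.cons_zero]
        linarith
      | succ i => simpa using hu i
    · have hx := LinearMap.congr_fun hbu x
      simp only [LinearMap.add_apply, LinearMap.smul_apply, smul_eq_mul, LinearMap.sum_apply,
        mul_add, Finset.sum_add_distrib, ← mul_assoc, ← Finset.sum_mul] at hx
      simp only [Fin.sum_univ_succ, Fin.cons_zero, Fin.cons_succ, LinearMap.add_apply,
        LinearMap.smul_apply, smul_eq_mul, LinearMap.sum_apply]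
      linarith

/-- A matrix of full column rank has a linear left inverse. -/
theorem Matrix.exists_leftInverse_mulVecLin_of_rank_eq {𝕜 : Type*} [Field 𝕜] {m d : ℕ}
    {A : Matrix (Fin m) (Fin d) 𝕜} (hA : A.rank = d) :
    ∃ g : (Fin m → 𝕜) →ₗ[𝕜] (Fin d → 𝕜), ∀ y, g (A *ᵥ y) = y := by
  have hker : LinearMap.ker A.mulVecLin = ⊥ := by
    have h := A.mulVecLin.finrank_range_add_finrank_ker
    rw [← Matrix.rank, hA, Module.finrank_fin_fun] at h
    exact Submodule.finrank_eq_zero.1 (by omega)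
  obtain ⟨g, hg⟩ := A.mulVecLin.exists_leftInverse_of_injective hker
  exact ⟨g, LinearMap.congr_fun hg⟩

/-- A nonnegative factorization of `A * X` through `ℝ^q` yields a linear extension of size `q`. -/
theorem exists_linear_extension_of_nonneg_factorization {m n d q : ℕ}
    {A : Matrix (Fin m) (Fin d) ℝ} {X : Matrix (Fin d) (Fin n) ℝ} (hrA : A.rank = d)
    {ξ : Fin m → Fin q → ℝ} {η : Fin n → Fin q → ℝ} (hξ : ∀ k i, 0 ≤ ξ k i)
    (hη : ∀ ℓ i, 0 ≤ η ℓ i) (hAX : ∀ k ℓ, (A * X) k ℓ = ξ k ⬝ᵥ η ℓ) :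
    ∃ (s : ℕ) (C : Matrix (Fin q) (Fin s) ℝ) (π : (Fin s → ℝ) →ₗ[ℝ] (Fin d → ℝ)),
      {y : Fin d → ℝ | ∃ c : Fin n → ℝ, (∀ j, 0 ≤ c j) ∧ y = X.mulVec c} ⊆
          π '' {x : Fin s → ℝ | ∀ i, 0 ≤ C.mulVec x i} ∧
      π '' {x : Fin s → ℝ | ∀ i, 0 ≤ C.mulVec x i} ⊆
          {y : Fin d → ℝ | ∀ i, 0 ≤ A.mulVec y i} := by
  obtain ⟨g, hg⟩ := Matrix.exists_leftInverse_mulVecLin_of_rank_eq hrA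
  let U : Matrix (Fin m) (Fin q) ℝ := Matrix.of ξ
  let V : Matrix (Fin q) (Fin n) ℝ := (Matrix.of η)ᵀ
  have hUV : A * X = U * V := Matrix.ext hAX
  let W : Submodule ℝ (Fin q → ℝ) := (LinearMap.range A.mulVecLin).comap U.mulVecLin
  let e : W ≃ₗ[ℝ] (Fin (Module.finrank ℝ W) → ℝ) := (Module.finBasis ℝ W).equivFun
  let f := W.subtype ∘ₗ e.symm.toLinearMap
  have hC : ∀ x, LinearMap.toMatrix' f *ᵥ x = f x := LinearMap.toMatrix'_mulVec f
  refine ⟨_, LinearMap.toMatrix' f, g ∘ₗ U.mulVecLin ∘ₗ f, ?_, ?_⟩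
  · rintro _ ⟨c, hc, rfl⟩
    have hVc : U *ᵥ (V *ᵥ c) = A *ᵥ (X *ᵥ c) := by
      rw [Matrix.mulVec_mulVec, Matrix.mulVec_mulVec, hUV]
    have hf : f (e ⟨V *ᵥ c, X *ᵥ c, hVc.symm⟩) = V *ᵥ c := by simp [f]
    refine ⟨e ⟨V *ᵥ c, X *ᵥ c, hVc.symm⟩, fun i => ?_, ?_⟩
    · rw [hC, hf]
      exact dotProduct_nonneg_of_nonneg (fun j => hη j i) hc
    · rw [LinearMap.comp_apply, LinearMap.comp_apply, hf, Matrix.mulVecLin_apply, hVc, hg]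
  · rintro _ ⟨x, hx, rfl⟩ k
    obtain ⟨y, hy⟩ := (e.symm x).2
    have hy' : A *ᵥ y = U *ᵥ f x := hy
    have hgy : (g ∘ₗ U.mulVecLin ∘ₗ f) x = y := by
      rw [LinearMap.comp_apply, LinearMap.comp_apply, Matrix.mulVecLin_apply, ← hy', hg]
    rw [hgy, hy']
    refine dotProduct_nonneg_of_nonneg (hξ k) ?_
    rw [← hC]
    exact hx

/-- A linear extension of size `q` yields a nonnegative factorization of `A * X`
through `ℝ^q`. -/
theorem exists_nonneg_factorization_of_linear_extension {m n d q s : ℕ}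
    {A : Matrix (Fin m) (Fin d) ℝ} {X : Matrix (Fin d) (Fin n) ℝ}
    {C : Matrix (Fin q) (Fin s) ℝ} {π : (Fin s → ℝ) →ₗ[ℝ] (Fin d → ℝ)}
    (hX : {y : Fin d → ℝ | ∃ c : Fin n → ℝ, (∀ j, 0 ≤ c j) ∧ y = X.mulVec c} ⊆
      π '' {x : Fin s → ℝ | ∀ i, 0 ≤ C.mulVec x i})
    (hA : π '' {x : Fin s → ℝ | ∀ i, 0 ≤ C.mulVec x i} ⊆
      {y : Fin d → ℝ | ∀ i, 0 ≤ A.mulVec y i}) :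
    ∃ (ξ : Fin m → Fin q → ℝ) (η : Fin n → Fin q → ℝ),
      (∀ k i, 0 ≤ ξ k i) ∧ (∀ ℓ i, 0 ≤ η ℓ i) ∧ ∀ k ℓ, (A * X) k ℓ = ξ k ⬝ᵥ η ℓ := by
  have hcol : ∀ ℓ, ∃ x : Fin s → ℝ, (∀ i, 0 ≤ (C *ᵥ x) i) ∧ π x = X.col ℓ := fun ℓ =>
    hX ⟨Pi.single ℓ 1, fun j => (Pi.single_nonneg.2 zero_le_one : (0 : Fin n → ℝ) ≤ Pi.single ℓ 1) j,
      (X.mulVec_single_one ℓ).symm⟩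
  choose x hx hπx using hcol
  have hrow : ∀ k, ∃ u : Fin q → ℝ, (∀ i, 0 ≤ u i) ∧
      LinearMap.proj k ∘ₗ A.mulVecLin ∘ₗ π = ∑ i, u i • (LinearMap.proj i ∘ₗ C.mulVecLin) :=
    fun k => exists_nonneg_sum_smul_eq_of_forall_nonneg _ _ fun z hz => hA ⟨z, hz, rfl⟩ k
  choose u hu hAu using hrow
  refine ⟨u, fun ℓ => C *ᵥ x ℓ, hu, hx, fun k ℓ => ?_⟩
  have h := LinearMap.congr_fun (hAu k) (x ℓ)
  simp only [LinearMap.comp_apply, LinearMap.proj_apply, Matrix.mulVecLin_apply, hπx,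
    LinearMap.sum_apply, LinearMap.smul_apply, smul_eq_mul] at h
  exact h

theorem nnegRank_eq_min_linear_extension {m n d : ℕ}
    (S : Matrix (Fin m) (Fin n) ℝ) (hS : ∀ k ℓ, 0 ≤ S k ℓ)
    (A : Matrix (Fin m) (Fin d) ℝ) (X : Matrix (Fin d) (Fin n) ℝ)
    (hSAX : S = A * X) (hrA : A.rank = d) (hrX : X.rank = d) :
    nnegRank S = sInf {q : ℕ | ∃ (s : ℕ) (C : Matrix (Fin q) (Fin s) ℝ)
      (π : (Fin s → ℝ) →ₗ[ℝ] (Fin d → ℝ)),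
      {y : Fin d → ℝ | ∃ c : Fin n → ℝ, (∀ j, 0 ≤ c j) ∧ y = X.mulVec c} ⊆
          π '' {x : Fin s → ℝ | ∀ i, 0 ≤ C.mulVec x i} ∧
      π '' {x : Fin s → ℝ | ∀ i, 0 ≤ C.mulVec x i} ⊆
          {y : Fin d → ℝ | ∀ i, 0 ≤ A.mulVec y i}} := by
  subst hSAX
  rw [nnegRank]
  congr 1
  ext q
  constructor
  · rintro ⟨ξ, η, hξ, hη, h⟩
    exact exists_linear_extension_of_nonneg_factorization hrA hξ hη h
  · rintro ⟨s, C, π, hX, hA⟩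
    exact exists_nonneg_factorization_of_linear_extension hX hA
end

section
/- Let S be a nonnegative real m×n matrix with S = AX for a real m×d matrix A and a real d×n matrix X, both of rank d. Let Q_0 ⊆ ℝ^d be the convex cone generated by the columns of X and let Q_1 := { x ∈ ℝ^d : Ax ≥ 0 } (so Q_0 ⊆ Q_1). Then the positive semidefinite rank of S equals the minimum q such that there exist a linear subspace L of the space of real symmetric q×q matrices and a linear map π from the space of real symmetric q×q matrices to ℝ^d with Q_0 ⊆ π(L ∩ PSD_q) ⊆ Q_1, where PSD_q denotes the cone of real positive semidefinite q×q matrices. -/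
open Matrix

/-- The `q × q` positive semidefinite matrices `A k`, `B ℓ` factor `S` through the trace form. -/
def HasPsdFactorization {m n : ℕ} (S : Matrix (Fin m) (Fin n) ℝ) (q : ℕ) : Prop :=
  ∃ (A : Fin m → Matrix (Fin q) (Fin q) ℝ) (B : Fin n → Matrix (Fin q) (Fin q) ℝ),
    (∀ k, (A k).PosSemidef) ∧ (∀ ℓ, (B ℓ).PosSemidef) ∧
    ∀ k ℓ, S k ℓ = ((A k)ᵀ * B ℓ).trace

/-- The cone generated by the columns of `X` and the cone `{y | 0 ≤ A y}` admit a positive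
semidefinite extension of size `q`. -/
def HasPsdExtension {m n d : ℕ} (A : Matrix (Fin m) (Fin d) ℝ) (X : Matrix (Fin d) (Fin n) ℝ)
    (q : ℕ) : Prop :=
  ∃ (L : Submodule ℝ (Matrix (Fin q) (Fin q) ℝ))
      (π : Matrix (Fin q) (Fin q) ℝ →ₗ[ℝ] (Fin d → ℝ)),
      (∀ Y ∈ L, Y.IsSymm) ∧
      {y : Fin d → ℝ | ∃ c : Fin n → ℝ, (∀ j, 0 ≤ c j) ∧ y = X.mulVec c} ⊆
          π '' {Y : Matrix (Fin q) (Fin q) ℝ | Y ∈ L ∧ Y.PosSemidef} ∧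
      π '' {Y : Matrix (Fin q) (Fin q) ℝ | Y ∈ L ∧ Y.PosSemidef} ⊆
          {y : Fin d → ℝ | ∀ i, 0 ≤ A.mulVec y i}

section SquareMatrix

variable {q : ℕ}

/-- A quadratic form is bounded below by a multiple of the squared norm. -/
lemma exists_neg_mul_dotProduct_self_le (Y : Matrix (Fin q) (Fin q) ℝ) :
    ∃ K : ℝ, 0 ≤ K ∧ ∀ u : Fin q → ℝ, -(K * (u ⬝ᵥ u)) ≤ u ⬝ᵥ Y *ᵥ u := by
  refine ⟨∑ i, ∑ j, |Y i j|, by positivity, fun u => ?_⟩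
  have hsq : ∀ i, u i ^ 2 ≤ u ⬝ᵥ u := fun i => by
    have := Finset.single_le_sum (f := fun i => u i * u i)
      (fun i _ => mul_self_nonneg (u i)) (Finset.mem_univ i)
    simpa [dotProduct, sq] using this
  have huYu : u ⬝ᵥ Y *ᵥ u = ∑ i, ∑ j, Y i j * (u i * u j) := by
    simp only [dotProduct, mulVec, Finset.mul_sum]
    exact Finset.sum_congr rfl fun i _ => Finset.sum_congr rfl fun j _ => by ring
  rw [huYu, Finset.sum_mul, ← Finset.sum_neg_distrib]
  refine Finset.sum_le_sum fun i _ => ?_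
  rw [Finset.sum_mul, ← Finset.sum_neg_distrib]
  refine Finset.sum_le_sum fun j _ => ?_
  have hij : |u i * u j| ≤ u ⬝ᵥ u := by
    rw [abs_le]
    constructor <;> nlinarith [hsq i, hsq j, sq_nonneg (u i + u j), sq_nonneg (u i - u j)]
  have := mul_le_mul_of_nonneg_left hij (abs_nonneg (Y i j))
  rw [← abs_mul] at this
  linarith [neg_abs_le (Y i j * (u i * u j))]

/-- A positive semidefinite matrix has a group inverse and is bounded away from zero on its
range. -/
lemma Matrix.PosSemidef.exists_groupInverse_and_bound {B : Matrix (Fin q) (Fin q) ℝ}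
    (hB : B.PosSemidef) :
    ∃ (G : Matrix (Fin q) (Fin q) ℝ) (c : ℝ), B * B * G = B ∧ 0 ≤ c ∧
      (c • (B * B * B) - B * B).PosSemidef := by
  set U : Matrix (Fin q) (Fin q) ℝ := hB.isHermitian.eigenvectorUnitary.1
  set l := hB.isHermitian.eigenvalues
  have hl : ∀ i, 0 ≤ l i := hB.eigenvalues_nonneg
  have hUU : star U * U = 1 := Unitary.coe_star_mul_self hB.isHermitian.eigenvectorUnitary
  have hspec : B = U * diagonal l * star U := by
    have := hB.isHermitian.spectral_theorem
    simpa [Unitary.conjStarAlgAut_apply, Function.comp_def] using this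
  have hmul : ∀ a b : Fin q → ℝ, (U * diagonal a * star U) * (U * diagonal b * star U) =
      U * diagonal (fun i => a i * b i) * star U := fun a b => by
    calc _ = U * diagonal a * (star U * U) * diagonal b * star U := by simp only [mul_assoc]
      _ = _ := by rw [hUU, mul_one, mul_assoc U, diagonal_mul_diagonal]
  have hsum : ∀ i, (l i)⁻¹ ≤ ∑ i, (l i)⁻¹ := fun i =>
    Finset.single_le_sum (f := fun i => (l i)⁻¹) (fun i _ => inv_nonneg.2 (hl i))
      (Finset.mem_univ i)
  refine ⟨U * diagonal (fun i => (l i)⁻¹) * star U, ∑ i, (l i)⁻¹, ?_,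
    Finset.sum_nonneg fun i _ => inv_nonneg.2 (hl i), ?_⟩
  · rw [hspec, hmul, hmul]
    congr 3
    funext i
    rcases eq_or_ne (l i) 0 with h | h
    · simp [h]
    · field_simp
  · have hd : (∑ i, (l i)⁻¹) • (B * B * B) - B * B =
        U * diagonal (fun i => (∑ i, (l i)⁻¹) * (l i * l i * l i) - l i * l i) * Uᴴ := by
      rw [hspec, hmul, hmul, ← star_eq_conjTranspose, ← smul_mul_assoc, ← mul_smul_comm,
        ← sub_mul, ← mul_sub, ← diagonal_smul, diagonal_sub]
      rfl
    rw [hd]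
    refine PosSemidef.mul_mul_conjTranspose_same (PosSemidef.diagonal fun i => ?_) U
    rcases eq_or_ne (l i) 0 with h | h
    · simp [h]
    · have := mul_le_mul_of_nonneg_right (hsum i) (mul_nonneg (mul_nonneg (hl i) (hl i)) (hl i))
      have h2 : (l i)⁻¹ * (l i * l i * l i) = l i * l i := by field_simp
      simp only [Pi.zero_apply]
      linarith

/-- Every linear functional on matrices that is nonnegative on positive semidefinite matrices is
given on symmetric matrices by the trace form with a positive semidefinite matrix. -/
lemma exists_posSemidef_trace_eq (g : Matrix (Fin q) (Fin q) ℝ →ₗ[ℝ] ℝ)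
    (hg : ∀ Y : Matrix (Fin q) (Fin q) ℝ, Y.PosSemidef → 0 ≤ g Y) :
    ∃ M : Matrix (Fin q) (Fin q) ℝ, M.PosSemidef ∧
      ∀ Y : Matrix (Fin q) (Fin q) ℝ, Y.IsSymm → g Y = (Mᵀ * Y).trace := by
  set N : Matrix (Fin q) (Fin q) ℝ := of fun i j => g (single i j 1)
  have hrep : ∀ Y, g Y = ∑ i, ∑ j, N i j * Y i j := fun Y => by
    conv_lhs => rw [matrix_eq_sum_single Y]
    simp only [map_sum]
    refine Finset.sum_congr rfl fun i _ => Finset.sum_congr rfl fun j _ => ?_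
    have : single i j (Y i j) = Y i j • single i j (1 : ℝ) := by simp
    rw [this, map_smul, smul_eq_mul, mul_comm]
    rfl
  have hsymm : ∀ Y : Matrix (Fin q) (Fin q) ℝ, Y.IsSymm → ∑ i, ∑ j, N j i * Y i j = g Y :=
    fun Y hY => by
      rw [hrep, Finset.sum_comm]
      exact Finset.sum_congr rfl fun i _ => Finset.sum_congr rfl fun j _ => by rw [hY.apply i j]
  have htr : ∀ Y : Matrix (Fin q) (Fin q) ℝ, Y.IsSymm →
      g Y = ∑ i, ∑ j, ((1 / 2 : ℝ) • (N + Nᵀ)) i j * Y i j := fun Y hY => by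
    have h : ∑ i, ∑ j, ((1 / 2 : ℝ) • (N + Nᵀ)) i j * Y i j =
        1 / 2 * (∑ i, ∑ j, N i j * Y i j + ∑ i, ∑ j, N j i * Y i j) := by
      simp only [Finset.mul_sum, ← Finset.sum_add_distrib]
      refine Finset.sum_congr rfl fun i _ => Finset.sum_congr rfl fun j _ => ?_
      simp only [Matrix.smul_apply, Matrix.add_apply, transpose_apply, smul_eq_mul]
      ring
    rw [h, hsymm Y hY, ← hrep]
    ring
  refine ⟨(1 / 2 : ℝ) • (N + Nᵀ), ?_, fun Y hY => ?_⟩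
  · refine PosSemidef.of_dotProduct_mulVec_nonneg ?_ fun v => ?_
    · ext i j
      simp [← mul_add, add_comm]
    · have hv : (vecMulVec v v).PosSemidef := by
        simpa using posSemidef_vecMulVec_self_star v
      have hvs : (vecMulVec v v).IsSymm := by
        ext i j
        simp [vecMulVec_apply, mul_comm]
      have h := hg _ hv
      rw [htr _ hvs] at h
      refine h.trans_eq ?_
      simp only [dotProduct, mulVec, Finset.mul_sum, vecMulVec_apply, star_trivial]
      exact Finset.sum_congr rfl fun i _ => Finset.sum_congr rfl fun j _ => by ring
  · rw [htr Y hY, Finset.sum_comm]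
    simp only [trace, diag_apply, mul_apply, transpose_apply]

/-- A symmetric matrix whose kernel contains that of `B` is positive semidefinite as soon as its
quadratic form is nonnegative on the range of `B`. -/
lemma posSemidef_of_nonneg_on_range {B Y : Matrix (Fin q) (Fin q) ℝ} (hB : B.PosSemidef)
    (hY : Y.IsSymm) (hker : ∀ v, B *ᵥ v = 0 → Y *ᵥ v = 0)
    (hnn : ∀ w, 0 ≤ (B *ᵥ w) ⬝ᵥ Y *ᵥ (B *ᵥ w)) : Y.PosSemidef := by
  obtain ⟨G, -, hG, -⟩ := hB.exists_groupInverse_and_bound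
  refine PosSemidef.of_dotProduct_mulVec_nonneg (by simpa using hY) fun v => ?_
  set a := B *ᵥ (G *ᵥ v) with ha
  have hb : Y *ᵥ (v - a) = 0 := hker _ <| by
    rw [ha, mulVec_sub, mulVec_mulVec, mulVec_mulVec, hG, sub_self]
  have hYv : Y *ᵥ v = Y *ᵥ a := by rwa [mulVec_sub, sub_eq_zero] at hb
  have hva : v ⬝ᵥ Y *ᵥ a = a ⬝ᵥ Y *ᵥ a := by
    rw [dotProduct_mulVec, ← mulVec_transpose, hY.eq, hYv, dotProduct_comm]
  rw [star_trivial, hYv, hva]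
  exact hnn _

/-- A functional nonnegative on the positive semidefinite part of a subspace `L` of symmetric
matrices agrees, on any finite family of positive semidefinite members of `L`, with the trace form
against a positive semidefinite matrix. -/
lemma exists_posSemidef_trace_eq_of_nonneg {n : ℕ} (L : Submodule ℝ (Matrix (Fin q) (Fin q) ℝ))
    (hL : ∀ Y ∈ L, Y.IsSymm) (f : Matrix (Fin q) (Fin q) ℝ →ₗ[ℝ] ℝ)
    (hf : ∀ Y ∈ L, Y.PosSemidef → 0 ≤ f Y) (B : Fin n → Matrix (Fin q) (Fin q) ℝ)
    (hBL : ∀ ℓ, B ℓ ∈ L) (hB : ∀ ℓ, (B ℓ).PosSemidef) :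
    ∃ M : Matrix (Fin q) (Fin q) ℝ, M.PosSemidef ∧ ∀ ℓ, f (B ℓ) = (Mᵀ * B ℓ).trace := by
  set C := ∑ ℓ, B ℓ with hC
  have hCpsd : C.PosSemidef := posSemidef_sum _ fun ℓ _ => hB ℓ
  have hCsymm : Cᵀ = C := by simpa using hCpsd.isHermitian.eq
  have hker : ∀ ℓ v, C *ᵥ v = 0 → B ℓ *ᵥ v = 0 := fun ℓ v hv => by
    have h0 : ∑ i, v ⬝ᵥ B i *ᵥ v = 0 := by
      rw [← dotProduct_sum, ← Matrix.sum_mulVec, ← hC, hv, dotProduct_zero]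
    have h1 := (Finset.sum_eq_zero_iff_of_nonneg fun i _ => by
      simpa using (hB i).dotProduct_mulVec_nonneg v).1 h0 ℓ (Finset.mem_univ ℓ)
    exact ((hB ℓ).dotProduct_mulVec_zero_iff v).1 (by simpa using h1)
  let D : Submodule ℝ (Matrix (Fin q) (Fin q) ℝ) :=
    { carrier := {Y | Y ∈ L ∧ ∀ v, C *ᵥ v = 0 → Y *ᵥ v = 0}
      add_mem' := fun ha hb => ⟨L.add_mem ha.1 hb.1, fun v hv => by
        rw [add_mulVec, ha.2 v hv, hb.2 v hv, add_zero]⟩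
      zero_mem' := ⟨L.zero_mem, fun v _ => zero_mulVec v⟩
      smul_mem' := fun c Y hY => ⟨L.smul_mem c hY.1, fun v hv => by
        rw [smul_mulVec, hY.2 v hv, smul_zero]⟩ }
  let K : PointedCone ℝ (Matrix (Fin q) (Fin q) ℝ) :=
    { carrier := {Y | ∀ w, 0 ≤ (C *ᵥ w) ⬝ᵥ Y *ᵥ (C *ᵥ w)}
      zero_mem' := fun w => by simp
      smul_mem' := fun c Y hY w => by
        change 0 ≤ (C *ᵥ w) ⬝ᵥ ((c : ℝ) • Y) *ᵥ (C *ᵥ w)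
        rw [smul_mulVec, dotProduct_smul]
        exact mul_nonneg c.2 (hY w)
      add_mem' := fun {Y Z} hY hZ w => by
        rw [add_mulVec, dotProduct_add]
        exact add_nonneg (hY w) (hZ w) }
  have hBD : ∀ ℓ, B ℓ ∈ D := fun ℓ => ⟨hBL ℓ, hker ℓ⟩
  have hCD : C ∈ D := D.sum_mem fun ℓ _ => hBD ℓ
  obtain ⟨g, hgf, hgK⟩ := riesz_extension K ⟨D, f ∘ₗ D.subtype⟩
    (fun Y hY => hf Y Y.2.1 (posSemidef_of_nonneg_on_range hCpsd (hL Y Y.2.1) Y.2.2 hY))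
    (fun Y => by
      obtain ⟨k, hk, hkY⟩ := exists_neg_mul_dotProduct_self_le Y
      obtain ⟨-, c, -, hc, hcC⟩ := hCpsd.exists_groupInverse_and_bound
      refine ⟨⟨(k * c) • C, D.smul_mem _ hCD⟩, fun w => ?_⟩
      have h1 := hkY (C *ᵥ w)
      have h2 := hcC.dotProduct_mulVec_nonneg w
      have h3 : w ⬝ᵥ (C * C) *ᵥ w = (C *ᵥ w) ⬝ᵥ (C *ᵥ w) := by
        rw [← mulVec_mulVec, dotProduct_mulVec, ← mulVec_transpose, hCsymm]
      have h4 : w ⬝ᵥ (C * C * C) *ᵥ w = (C *ᵥ w) ⬝ᵥ C *ᵥ (C *ᵥ w) := by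
        rw [mul_assoc, ← mulVec_mulVec, dotProduct_mulVec, ← mulVec_transpose, hCsymm,
          ← mulVec_mulVec]
      rw [star_trivial, sub_mulVec, dotProduct_sub, smul_mulVec, dotProduct_smul, h3, h4,
        smul_eq_mul] at h2
      have h5 := mul_nonneg hk h2
      change 0 ≤ (C *ᵥ w) ⬝ᵥ ((k * c) • C + Y) *ᵥ (C *ᵥ w)
      rw [add_mulVec, dotProduct_add, smul_mulVec, dotProduct_smul, smul_eq_mul]
      linarith)
  obtain ⟨M, hM, hMg⟩ := exists_posSemidef_trace_eq g fun Y hY =>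
    hgK Y fun w => by simpa using hY.dotProduct_mulVec_nonneg (C *ᵥ w)
  exact ⟨M, hM, fun ℓ => by
    rw [← hMg _ (hL _ (hBL ℓ))]
    exact (hgf ⟨B ℓ, hBD ℓ⟩).symm⟩

/-- The trace form is nonnegative on pairs of positive semidefinite matrices. -/
lemma Matrix.PosSemidef.trace_transpose_mul_nonneg {M Y : Matrix (Fin q) (Fin q) ℝ}
    (hM : M.PosSemidef) (hY : Y.PosSemidef) : 0 ≤ (Mᵀ * Y).trace := by
  obtain ⟨r, a, ha⟩ := posSemidef_iff_eq_sum_vecMulVec.1 hM.transpose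
  rw [ha, Matrix.sum_mul, trace_sum]
  refine Finset.sum_nonneg fun i _ => ?_
  rw [vecMulVec_mul, trace_vecMulVec, dotProduct_comm, ← dotProduct_mulVec]
  exact hY.dotProduct_mulVec_nonneg (a i)

end SquareMatrix

lemma HasPsdExtension.hasPsdFactorization {m n d q : ℕ} {A : Matrix (Fin m) (Fin d) ℝ}
    {X : Matrix (Fin d) (Fin n) ℝ} (h : HasPsdExtension A X q) :
    HasPsdFactorization (A * X) q := by
  obtain ⟨L, π, hL, hX, hA⟩ := h
  have hcol : ∀ ℓ, ∃ Y : Matrix (Fin q) (Fin q) ℝ, (Y ∈ L ∧ Y.PosSemidef) ∧ π Y = X.col ℓ :=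
    fun ℓ => hX ⟨Pi.single ℓ 1, fun j => by
      rcases eq_or_ne j ℓ with rfl | hj <;> simp [*], by simp⟩
  choose B hB hBX using hcol
  have hex := fun k => exists_posSemidef_trace_eq_of_nonneg L hL
    (LinearMap.proj k ∘ₗ A.mulVecLin ∘ₗ π)
    (fun Y hY hYp => hA ⟨Y, ⟨hY, hYp⟩, rfl⟩ k) B (fun ℓ => (hB ℓ).1) (fun ℓ => (hB ℓ).2)
  choose M hM hMB using hex
  refine ⟨M, B, hM, fun ℓ => (hB ℓ).2, fun k ℓ => ?_⟩
  rw [← hMB k ℓ]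
  simp [hBX, mul_apply, mulVec, dotProduct]

lemma HasPsdFactorization.hasPsdExtension {m n d q : ℕ} {A : Matrix (Fin m) (Fin d) ℝ}
    {X : Matrix (Fin d) (Fin n) ℝ} (hA : A.rank = d) (h : HasPsdFactorization (A * X) q) :
    HasPsdExtension A X q := by
  obtain ⟨M, B, hM, hB, hMB⟩ := h
  have hinj : LinearMap.ker A.mulVecLin = ⊥ := by
    have := A.mulVecLin.finrank_range_add_finrank_ker
    rw [← Matrix.rank, hA, Module.finrank_fin_fun] at this
    exact Submodule.finrank_eq_zero.1 (by omega)
  obtain ⟨P, hP⟩ := A.mulVecLin.exists_leftInverse_of_injective hinj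
  have hPA : ∀ y, P (A *ᵥ y) = y := fun y => LinearMap.congr_fun hP y
  let T : Matrix (Fin q) (Fin q) ℝ →ₗ[ℝ] (Fin m → ℝ) :=
    LinearMap.pi fun k => traceLinearMap (Fin q) ℝ ℝ ∘ₗ LinearMap.mulLeft ℝ (M k)ᵀ
  have hT : ∀ Y k, T Y k = ((M k)ᵀ * Y).trace := fun Y k => rfl
  have hTB : ∀ ℓ, T (B ℓ) = A *ᵥ X.col ℓ := fun ℓ => by
    ext k
    rw [hT, ← hMB]
    rfl
  let L : Submodule ℝ (Matrix (Fin q) (Fin q) ℝ) :=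
    { carrier := {Y | Y.IsSymm ∧ ∃ y, T Y = A *ᵥ y}
      add_mem' := by
        rintro Y Z ⟨hY, y, hy⟩ ⟨hZ, z, hz⟩
        exact ⟨hY.add hZ, y + z, by rw [map_add, hy, hz, mulVec_add]⟩
      zero_mem' := ⟨isSymm_zero, 0, by simp⟩
      smul_mem' := by
        rintro c Y ⟨hY, y, hy⟩
        exact ⟨hY.smul c, c • y, by rw [map_smul, hy, mulVec_smul]⟩ }
  have hBL : ∀ ℓ, B ℓ ∈ L := fun ℓ =>
    ⟨isHermitian_iff_isSymm.1 (hB ℓ).isHermitian, X.col ℓ, hTB ℓ⟩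
  refine ⟨L, P ∘ₗ T, fun Y hY => hY.1, ?_, ?_⟩
  · rintro _ ⟨c, hc, rfl⟩
    refine ⟨∑ ℓ, c ℓ • B ℓ, ⟨L.sum_mem fun ℓ _ => L.smul_mem _ (hBL ℓ),
      posSemidef_sum _ fun ℓ _ => (hB ℓ).smul (hc ℓ)⟩, ?_⟩
    simp only [LinearMap.comp_apply, map_sum, map_smul, hTB, hPA]
    ext i
    simp [mulVec, dotProduct, mul_comm]
  · rintro _ ⟨Y, ⟨⟨-, y, hy⟩, hY⟩, rfl⟩ k
    rw [LinearMap.comp_apply, hy, hPA, ← hy, hT]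
    exact (hM k).trace_transpose_mul_nonneg hY

theorem psdRank_eq_min_psd_extension {m n d : ℕ}
    (S : Matrix (Fin m) (Fin n) ℝ) (hS : ∀ k ℓ, 0 ≤ S k ℓ)
    (A : Matrix (Fin m) (Fin d) ℝ) (X : Matrix (Fin d) (Fin n) ℝ)
    (hSAX : S = A * X) (hrA : A.rank = d) (hrX : X.rank = d) :
    psdRank S = sInf {q : ℕ | ∃ (L : Submodule ℝ (Matrix (Fin q) (Fin q) ℝ))
      (π : Matrix (Fin q) (Fin q) ℝ →ₗ[ℝ] (Fin d → ℝ)),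
      (∀ Y ∈ L, Y.IsSymm) ∧
      {y : Fin d → ℝ | ∃ c : Fin n → ℝ, (∀ j, 0 ≤ c j) ∧ y = X.mulVec c} ⊆
          π '' {Y : Matrix (Fin q) (Fin q) ℝ | Y ∈ L ∧ Y.PosSemidef} ∧
      π '' {Y : Matrix (Fin q) (Fin q) ℝ | Y ∈ L ∧ Y.PosSemidef} ⊆
          {y : Fin d → ℝ | ∀ i, 0 ≤ A.mulVec y i}} := by
  subst hSAX
  exact congrArg sInf (Set.ext fun q =>
    ⟨HasPsdFactorization.hasPsdExtension hrA, HasPsdExtension.hasPsdFactorization⟩)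
end
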